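/- The minimum norm of a unimodular lattice L in dimension 36 is at most 4. -/

import Mathlib

/-- The dual of a set of vectors in `ℝⁿ`. -/
def dualLattice {n : ℕ} (L : Set (Fin n → ℝ)) : Set (Fin n → ℝ) :=
  {v | ∀ w ∈ L, ∃ m : ℤ, ∑ i, v i * w i = (m : ℝ)}

open MeasureTheory Set Module
open scoped RealInnerProductSpace

section Poisson

variable {ι : Type*} [Fintype ι]

lemma mFourier_coe (k : ι → ℤ) (t : ι → ℝ) :
    UnitAddTorus.mFourier k (fun i => (t i : UnitAddCircle)) =
      Complex.exp (2 * Real.pi * Complex.I * ((∑ i, k i * t i : ℝ) : ℂ)) := by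
  simp only [UnitAddTorus.mFourier, ContinuousMap.coe_mk, fourier_coe_apply]
  rw [← Complex.exp_sum]
  congr 1
  push_cast
  rw [Finset.mul_sum]
  refine Finset.sum_congr rfl fun i _ => ?_
  simp
  ring

/-- The unit box with lower corner `a`. -/
def unitBox (a : ι → ℝ) : Set (ι → ℝ) := {x | ∀ i, x i ∈ Ioc (a i) (a i + 1)}

lemma measurableSet_unitBox (a : ι → ℝ) : MeasurableSet (unitBox a) := by
  have : unitBox a = Set.univ.pi fun i => Ioc (a i) (a i + 1) := by
    ext; simp [unitBox]
  rw [this]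
  exact MeasurableSet.univ_pi fun i => measurableSet_Ioc

lemma volume_unitBox (a : ι → ℝ) : volume (unitBox a) = 1 := by
  have : unitBox a = Set.univ.pi fun i => Ioc (a i) (a i + 1) := by
    ext; simp [unitBox]
  rw [this, Real.volume_pi_Ioc]
  simp

lemma hasSum_integral_unitBox {f : (ι → ℝ) → ℂ} (hf : Integrable f) :
    HasSum (fun m : ι → ℤ => ∫ t in unitBox (0 : ι → ℝ), f (t + fun i => (m i : ℝ)))
      (∫ t, f t) := by
  have hU : (⋃ m : ι → ℤ, unitBox (fun i => (m i : ℝ))) = (Set.univ : Set (ι → ℝ)) := by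
    ext x
    simp only [mem_iUnion, mem_univ, iff_true]
    refine ⟨fun i => ⌈x i⌉ - 1, fun i => ?_⟩
    push_cast
    constructor
    · linarith [Int.ceil_lt_add_one (x i)]
    · linarith [Int.le_ceil (x i)]
  have hd : Pairwise (Function.onFun Disjoint fun m : ι → ℤ =>
      unitBox (fun i => (m i : ℝ))) := by
    intro m m' hmm
    refine Set.disjoint_left.2 fun x hx hx' => hmm (funext fun i => ?_)
    have h1 := hx i
    have h2 := hx' i
    have h3 : (m i : ℝ) < m' i + 1 := h1.1.trans_le h2.2
    have h4 : (m' i : ℝ) < m i + 1 := h2.1.trans_le h1.2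
    norm_cast at h3 h4
    lia
  have := hasSum_integral_iUnion (μ := (volume : Measure (ι → ℝ))) (f := f)
    (s := fun m : ι → ℤ => unitBox (fun i => (m i : ℝ)))
    (fun m => measurableSet_unitBox _) hd hf.integrableOn
  rw [hU, setIntegral_univ] at this
  have h0 : (fun m : ι → ℤ => ∫ t in unitBox (0 : ι → ℝ), f (t + fun i => (m i : ℝ))) =
      fun m => ∫ t in unitBox (fun i => (m i : ℝ)), f t := by
    funext m
    have hp := (measurePreserving_add_right (volume : Measure (ι → ℝ))
      (fun i => (m i : ℝ))).setIntegral_preimage_emb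
      (MeasurableEquiv.addRight (fun i => (m i : ℝ))).measurableEmbedding f
      (unitBox (fun i => (m i : ℝ)))
    rw [← hp]
    congr 2
    ext x
    simp only [unitBox, mem_ofPred_eq, mem_preimage, Pi.zero_apply, Pi.add_apply, mem_Ioc]
    refine forall_congr' fun i => ?_
    constructor <;> rintro ⟨h1, h2⟩ <;> constructor <;> linarith
  rw [h0]
  exact this

/-- **Poisson summation** over `ℤᵈ`. -/
theorem tsum_pi_eq_tsum_fourierIntegral {f : (ι → ℝ) → ℂ} (hc : Continuous f) (hi : Integrable f)
    (hb : ∀ R : ℝ, ∃ u : (ι → ℤ) → ℝ, Summable u ∧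
      ∀ m, ∀ t : ι → ℝ, ‖t‖ ≤ R → ‖f (t + fun i => (m i : ℝ))‖ ≤ u m)
    (hs : Summable fun k : ι → ℤ =>
      ∫ t, Complex.exp (-(2 * Real.pi * Complex.I * ((∑ i, k i * t i : ℝ) : ℂ))) * f t)
    (t : ι → ℝ) :
    ∑' m : ι → ℤ, f (t + fun i => (m i : ℝ)) =
      ∑' k : ι → ℤ, (∫ t, Complex.exp (-(2 * Real.pi * Complex.I * ((∑ i, k i * t i : ℝ) : ℂ)))
        * f t) * Complex.exp (2 * Real.pi * Complex.I * ((∑ i, k i * t i : ℝ) : ℂ)) := by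
  set P : (ι → ℝ) → ℂ := fun t => ∑' m : ι → ℤ, f (t + fun i => (m i : ℝ)) with hP
  have hPc : Continuous P := by
    rw [continuous_iff_continuousAt]
    intro t₀
    obtain ⟨u, hu, hub⟩ := hb (‖t₀‖ + 1)
    have : ContinuousOn P (Metric.ball 0 (‖t₀‖ + 1)) := by
      refine continuousOn_tsum (fun m => ?_) hu fun m t ht => hub m t ?_
      · exact (hc.comp (continuous_id.add continuous_const)).continuousOn
      · exact (mem_ball_zero_iff.1 ht).le
    refine this.continuousAt (Metric.isOpen_ball.mem_nhds ?_)
    simp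
  set q : (ι → ℝ) → UnitAddTorus ι := fun t i => (t i : UnitAddCircle) with hq
  have hqq : Topology.IsQuotientMap q :=
    (IsOpenQuotientMap.piMap (fun _ : ι => (QuotientAddGroup.isOpenQuotientMap_mk :
      IsOpenQuotientMap ((↑) : ℝ → UnitAddCircle)))).isQuotientMap
  have hPq : ∀ a b, q a = q b → P a = P b := by
    intro a b hab
    have h1 : ∀ i, ∃ n : ℤ, a i = b i + n := by
      intro i
      have := congrFun hab i
      simp only [hq] at this
      rw [← sub_eq_zero, ← AddCircle.coe_sub, AddCircle.coe_eq_zero_iff] at this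
      obtain ⟨n, hn⟩ := this
      refine ⟨n, ?_⟩
      rw [zsmul_eq_mul, mul_one] at hn
      linarith
    choose n hn using h1
    have : a = b + fun i => (n i : ℝ) := funext hn
    rw [this]
    simp only [hP]
    rw [← (Equiv.addLeft n).tsum_eq (fun m : ι → ℤ => f (b + fun i => (m i : ℝ)))]
    refine tsum_congr fun m => ?_
    congr 1
    ext i
    simp [add_assoc]
  let F : C(UnitAddTorus ι, ℂ) := ⟨fun x => P (Function.surjInv hqq.surjective x), by
    rw [hqq.continuous_iff]
    convert hPc using 1
    ext a
    exact hPq _ _ (Function.surjInv_eq hqq.surjective _)⟩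
  have hF : ∀ a, F (q a) = P a := fun a => hPq _ _ (Function.surjInv_eq hqq.surjective _)
  have hcoeff : ∀ k, UnitAddTorus.mFourierCoeff F k =
      ∫ t, Complex.exp (-(2 * Real.pi * Complex.I * ((∑ i, k i * t i : ℝ) : ℂ))) * f t := by
    intro k
    set e : (ι → ℝ) → ℂ := fun t =>
      Complex.exp (-(2 * Real.pi * Complex.I * ((∑ i, k i * t i : ℝ) : ℂ))) with he
    have hec : Continuous e := by fun_prop
    have hen : ∀ t, ‖e t‖ = 1 := by
      intro t
      have := Complex.norm_exp_ofReal_mul_I (-(2 * Real.pi * ∑ i, k i * t i))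
      rw [← this, he]
      congr 2
      push_cast
      ring_nf
    have hef : Integrable fun t => e t * f t := by
      refine hi.bdd_mul hec.aestronglyMeasurable (c := 1) (Filter.Eventually.of_forall fun t => ?_)
      rw [hen]
    have hper : ∀ (t : ι → ℝ) (m : ι → ℤ), e (t + fun i => (m i : ℝ)) = e t := by
      intro t m
      simp only [he]
      rw [Complex.exp_eq_exp_iff_exists_int]
      refine ⟨-∑ i, k i * m i, ?_⟩
      have : ∑ i, (k i : ℝ) * (t + fun i => (m i : ℝ)) i =
          ∑ i, k i * t i + ((∑ i, k i * m i : ℤ) : ℝ) := by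
        push_cast
        rw [← Finset.sum_add_distrib]
        exact Finset.sum_congr rfl fun i _ => by simp [mul_add]
      rw [this]
      push_cast
      ring
    rw [UnitAddTorus.mFourierCoeff_eq_integral _ _ 0]
    have h1 := hasSum_integral_unitBox hef
    obtain ⟨u, hu, hub⟩ := hb 1
    have hbox : ∀ t ∈ unitBox (0 : ι → ℝ), ‖t‖ ≤ 1 := by
      intro t ht
      rw [pi_norm_le_iff_of_nonneg zero_le_one]
      intro i
      have := ht i
      simp only [Pi.zero_apply, mem_Ioc, zero_add] at this
      rw [Real.norm_eq_abs, abs_le]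
      constructor <;> linarith
    have h2 := hasSum_integral_of_summable_integral_norm
      (μ := (volume : Measure (ι → ℝ)).restrict (unitBox 0))
      (F := fun (m : ι → ℤ) t => e (t + fun i => (m i : ℝ)) * f (t + fun i => (m i : ℝ)))
      (fun m => (hef.comp_add_right _).integrableOn) (by
        refine Summable.of_nonneg_of_le (fun m => integral_nonneg fun _ => norm_nonneg _)
          (fun m => ?_) hu
        have h3 := norm_setIntegral_le_of_norm_le_const
          (μ := (volume : Measure (ι → ℝ))) (s := unitBox 0) (C := u m)
          (f := fun t => ‖e (t + fun i => (m i : ℝ)) * f (t + fun i => (m i : ℝ))‖)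
          (by rw [volume_unitBox]; simp) (fun t ht => by
            rw [norm_norm, norm_mul, hen, one_mul]; exact hub m t (hbox t ht))
        rw [Measure.real, volume_unitBox] at h3
        simpa using (le_abs_self _).trans h3)
    change ∫ x in unitBox 0, _ = _
    rw [h1.unique h2]
    refine setIntegral_congr_fun (measurableSet_unitBox 0) fun t _ => ?_
    simp only [hper]
    rw [tsum_mul_left, smul_eq_mul, mFourier_coe]
    congr 1
    · simp [he]
    · exact hF t
  have hs' : Summable (UnitAddTorus.mFourierCoeff F) := by
    convert hs using 1
    exact funext hcoeff
  have := (UnitAddTorus.hasSum_mFourier_series_apply_of_summable hs' (q t)).tsum_eq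
  rw [hF] at this
  change P t = _
  rw [← this]
  refine tsum_congr fun k => ?_
  rw [hcoeff, smul_eq_mul, mFourier_coe]

end Poisson

section Lattice

variable {E : Type*} [NormedAddCommGroup E] [InnerProductSpace ℝ E]

/-- A `ℤ`-submodule of a Euclidean space which equals its dual. -/
def IsSelfDual (L : Submodule ℤ E) : Prop :=
  ∀ v : E, v ∈ L ↔ ∀ w ∈ L, ∃ m : ℤ, ⟪v, w⟫ = m

lemma norm_add_sq_ge (x v : E) : ‖x‖ ^ 2 / 2 - ‖v‖ ^ 2 ≤ ‖x + v‖ ^ 2 := by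
  have h := parallelogram_law_with_norm ℝ (x + v) v
  have h2 : ‖x‖ ^ 2 ≤ (‖x + v‖ + ‖v‖) ^ 2 := by
    have : ‖x‖ ≤ ‖x + v‖ + ‖v‖ := by simpa using norm_sub_le (x + v) v
    gcongr
  nlinarith [sq_nonneg (‖x + v‖ - ‖v‖)]

variable [FiniteDimensional ℝ E] (L : Submodule ℤ E) [DiscreteTopology L]

lemma summable_exp_neg_norm_sq {a : ℝ} (ha : 0 < a) :
    Summable fun x : L => Real.exp (-(a * ‖x‖ ^ 2)) := by
  have := ZLattice.summable_norm_pow_inv L (2 * (finrank ℤ L + 1)) (by lia)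
  refine Summable.of_norm_bounded_eventually
    (this.mul_left ((finrank ℤ L + 1).factorial / a ^ (finrank ℤ L + 1))) ?_
  refine Filter.mem_of_superset (Set.finite_singleton (0 : L)).compl_mem_cofinite ?_
  intro x hx
  have hx0 : 0 < ‖x‖ := norm_pos_iff.2 hx
  have h1 : 0 < a * ‖x‖ ^ 2 := by positivity
  have h2 := Real.pow_div_factorial_le_exp _ h1.le (finrank ℤ L + 1)
  simp only [mem_ofPred_eq, Real.norm_eq_abs, Real.abs_exp]
  rw [Real.exp_neg]
  refine (inv_anti₀ (by positivity) h2).trans (le_of_eq ?_)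
  rw [pow_mul, mul_pow, inv_div, inv_pow, inv_pow]
  field_simp

lemma summable_exp_neg_norm_add_sq {a : ℝ} (ha : 0 < a) (v : E) :
    Summable fun x : L => Real.exp (-(a * ‖(x : E) + v‖ ^ 2)) := by
  refine Summable.of_nonneg_of_le (fun x => (Real.exp_pos _).le) (fun x => ?_)
    ((summable_exp_neg_norm_sq L (half_pos ha)).mul_left (Real.exp (a * ‖v‖ ^ 2)))
  rw [← Real.exp_add, Real.exp_le_exp]
  have := norm_add_sq_ge (x : E) v
  rw [Submodule.coe_norm]
  nlinarith

lemma norm_cexp_mul_norm_sq {E : Type*} [NormedAddCommGroup E] (τ : ℂ) (x : E) :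
    ‖Complex.exp (Real.pi * Complex.I * τ * (‖x‖ ^ 2 : ℝ))‖ =
      Real.exp (-(Real.pi * τ.im * ‖x‖ ^ 2)) := by
  rw [Complex.norm_exp]
  congr 1
  rw [Complex.re_mul_ofReal]
  simp

variable [IsZLattice ℝ L]

variable {L} in
/-- Coordinates of the self-dual lattice with respect to the dual of a basis. -/
lemma IsSelfDual.exists_dual_equiv (hL : IsSelfDual L) {ι : Type*} [Fintype ι] (b : Basis ι ℤ L) :
    ∃ e : (ι → ℤ) ≃ L, ∀ k i, ⟪(e k : E), (b i : E)⟫ = k i := by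
  have hspan : ∀ x : L, (x : E) = ∑ i, b.repr x i • (b i : E) := by
    intro x
    conv_lhs => rw [← b.sum_repr x]
    rw [Submodule.coe_sum]
    simp
  have h1 : ∀ k : ι → ℤ, ∃ y : L, ∀ i, ⟪(y : E), (b i : E)⟫ = k i := by
    intro k
    let φ : E →ₗ[ℝ] ℝ := (b.ofZLatticeBasis ℝ L).constr ℝ fun i => (k i : ℝ)
    have hφ : ∀ i, φ (b i) = k i := fun i => by
      have := (b.ofZLatticeBasis ℝ L).constr_basis ℝ (fun i => (k i : ℝ)) i
      rwa [b.ofZLatticeBasis_apply ℝ] at this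
    let v : E := (InnerProductSpace.toDual ℝ E).symm (LinearMap.toContinuousLinearMap φ)
    have hv : ∀ w, ⟪v, w⟫ = φ w := fun w => by
      simp [v]
    have hvL : v ∈ L := by
      rw [hL]
      intro w hw
      refine ⟨∑ i, b.repr ⟨w, hw⟩ i * k i, ?_⟩
      have := hspan ⟨w, hw⟩
      simp only at this
      rw [hv, congrArg φ this, map_sum]
      push_cast
      refine Finset.sum_congr rfl fun i _ => ?_
      rw [map_zsmul, hφ, zsmul_eq_mul]
    exact ⟨⟨v, hvL⟩, fun i => (hv _).trans (hφ i)⟩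
  choose e he using h1
  have hinj : Function.Injective e := by
    intro k k' h
    funext i
    have h2 := he k i
    rw [h, he k' i] at h2
    exact_mod_cast h2.symm
  have hsurj : Function.Surjective e := by
    intro y
    choose k hk using fun i => (hL y).1 y.2 (b i) (b i).2
    refine ⟨k, Subtype.ext ?_⟩
    refine InnerProductSpace.ext_inner_right_basis (b.ofZLatticeBasis ℝ L) fun i => ?_
    rw [b.ofZLatticeBasis_apply ℝ, he, hk]
  exact ⟨Equiv.ofBijective e ⟨hinj, hsurj⟩, he⟩

variable [MeasurableSpace E] [BorelSpace E]

variable {L} in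
/-- The theta transformation law of a self-dual lattice, up to a covolume factor. -/
theorem IsSelfDual.exists_tsum_eq (hL : IsSelfDual L) :
    ∃ c : ℝ, ∀ τ : ℂ, 0 < τ.im → ∀ v : E,
      ∑' x : L, Complex.exp (Real.pi * Complex.I * τ * (‖(x : E) + v‖ ^ 2 : ℝ)) =
        c * (-(Complex.I * τ))⁻¹ ^ (finrank ℝ E / 2 : ℂ) *
          ∑' y : L, Complex.exp (Real.pi * Complex.I * (-1 / τ) * (‖(y : E)‖ ^ 2 : ℝ)) *
            Complex.exp (2 * Real.pi * Complex.I * (⟪(y : E), v⟫ : ℝ)) := by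
  have : Module.Free ℤ L := ZLattice.module_free ℝ L
  have : Module.Finite ℤ L := ZLattice.module_finite ℝ L
  let b := Module.Free.chooseBasis ℤ L
  obtain ⟨e, he⟩ := hL.exists_dual_equiv b
  let A : (Free.ChooseBasisIndex ℤ L → ℝ) ≃L[ℝ] E :=
    (b.ofZLatticeBasis ℝ L).equivFun.symm.toContinuousLinearEquiv
  have hA : ∀ t, A t = ∑ i, t i • (b i : E) := by
    intro t
    simp [A, Basis.equivFun_symm_apply]
  have hAk : ∀ k t, ⟪(e k : E), A t⟫ = ∑ i, k i * t i := by
    intro k t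
    rw [hA, inner_sum]
    refine Finset.sum_congr rfl fun i _ => ?_
    rw [real_inner_smul_right, he, mul_comm]
  have hAm : ∀ m : Free.ChooseBasisIndex ℤ L → ℤ,
      A (fun i => (m i : ℝ)) = (b.equivFun.symm m : L) := by
    intro m
    rw [hA, Basis.equivFun_symm_apply, Submodule.coe_sum]
    refine Finset.sum_congr rfl fun i _ => ?_
    rw [Submodule.coe_smul, Int.cast_smul_eq_zsmul]
  let A' := A.toHomeomorph.toMeasurableEquiv
  set c := Measure.addHaarScalarFactor
    (Measure.map A (volume : Measure (Free.ChooseBasisIndex ℤ L → ℝ))) (volume : Measure E)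
  have hc : Measure.map A' (volume : Measure (Free.ChooseBasisIndex ℤ L → ℝ)) =
      c • (volume : Measure E) :=
    Measure.isAddLeftInvariant_eq_smul (Measure.map A volume) volume
  have hcov : ∀ h : E → ℂ, ∫ t, h (A t) = c • ∫ x, h x := by
    intro h
    rw [← integral_smul_nnreal_measure, ← hc, integral_map_equiv A']
    rfl
  refine ⟨c, fun τ hτ v => ?_⟩
  have hτ0 : τ ≠ 0 := by rintro rfl; simp at hτ
  set g : E → ℂ := fun x => Complex.exp (Real.pi * Complex.I * τ * (‖x‖ ^ 2 : ℝ)) with hg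
  have hbre : 0 < (-(Real.pi * Complex.I * τ)).re := by
    simp [Real.pi_pos, hτ]
  have hgi : Integrable g := by
    have := GaussianFourier.integrable_cexp_neg_mul_sq_norm_add hbre 0 (0 : E)
    simpa [hg] using this
  have hfi : Integrable fun t => g (A t) := by
    have h1 : Integrable g (Measure.map A' volume) := by
      rw [hc]
      exact hgi.smul_measure_nnreal
    exact (integrable_map_equiv A' g).1 h1
  have hgc : Continuous g := by fun_prop
  have hF : ∀ k : Free.ChooseBasisIndex ℤ L → ℤ,
      ∫ t, Complex.exp (-(2 * Real.pi * Complex.I * ((∑ i, k i * t i : ℝ) : ℂ))) * g (A t) =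
        c * (-(Complex.I * τ))⁻¹ ^ (finrank ℝ E / 2 : ℂ) *
          Complex.exp (Real.pi * Complex.I * (-1 / τ) * (‖(e k : E)‖ ^ 2 : ℝ)) := by
    intro k
    have := hcov fun x => Complex.exp (-(2 * Real.pi * Complex.I * (⟪(e k : E), x⟫ : ℝ))) * g x
    simp only [hAk] at this
    rw [this]
    have h2 := GaussianFourier.integral_cexp_neg_mul_sq_norm_add hbre
      (-(2 * Real.pi * Complex.I)) (e k : E)
    have h3 : ∀ x : E, Complex.exp (-(2 * Real.pi * Complex.I * (⟪(e k : E), x⟫ : ℝ))) * g x =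
        Complex.exp (-(-(Real.pi * Complex.I * τ)) * ‖x‖ ^ 2 +
          -(2 * Real.pi * Complex.I) * (⟪(e k : E), x⟫ : ℝ)) := by
      intro x
      rw [hg, ← Complex.exp_add]
      congr 1
      push_cast
      ring
    simp only [h3]
    have hpi : (Real.pi : ℂ) ≠ 0 := by exact_mod_cast Real.pi_ne_zero
    have h4 : (Real.pi : ℂ) / -(Real.pi * Complex.I * τ) = (-(Complex.I * τ))⁻¹ := by
      field_simp
    have h5 : (-(2 * (Real.pi : ℂ) * Complex.I)) ^ 2 * (‖(e k : E)‖ : ℂ) ^ 2 /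
        (4 * -(Real.pi * Complex.I * τ)) =
        Real.pi * Complex.I * (-1 / τ) * (‖(e k : E)‖ ^ 2 : ℝ) := by
      push_cast
      field_simp
      ring
    rw [h2, NNReal.smul_def, Complex.real_smul, h4, h5, ← mul_assoc]
  have hτ' : 0 < (-1 / τ).im := by
    rw [neg_div, one_div, Complex.neg_im, Complex.inv_im, neg_div, neg_neg]
    exact div_pos hτ (Complex.normSq_pos.2 hτ0)
  have key := tsum_pi_eq_tsum_fourierIntegral (f := fun t => g (A t)) (hgc.comp A.continuous) hfi
    (fun R => ?_) ?_ (A.symm v)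
  · simp only [hF] at key
    rw [← b.equivFun.symm.toEquiv.tsum_eq, ← e.tsum_eq, ← tsum_mul_left]
    refine Eq.trans (tsum_congr fun m => ?_) (key.trans (tsum_congr fun k => ?_))
    · rw [map_add, hAm, A.apply_symm_apply, add_comm]
      rfl
    · rw [← hAk, A.apply_symm_apply, mul_assoc]
  · obtain ⟨C, hC0, hC⟩ := A.toContinuousLinearMap.bound
    refine ⟨fun m => Real.exp (Real.pi * τ.im * (C * R) ^ 2) *
      Real.exp (-(Real.pi * τ.im / 2 * ‖b.equivFun.symm m‖ ^ 2)), ?_, fun m t ht => ?_⟩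
    · have := summable_exp_neg_norm_sq L (a := Real.pi * τ.im / 2) (by positivity)
      exact (b.equivFun.symm.toEquiv.summable_iff.2 this).mul_left _
    · rw [hg]
      simp only
      rw [norm_cexp_mul_norm_sq, ← Real.exp_add, Real.exp_le_exp, map_add, hAm, add_comm (A t)]
      have h1 := norm_add_sq_ge (b.equivFun.symm m : E) (A t)
      have h2 : ‖A t‖ ^ 2 ≤ (C * R) ^ 2 := by
        have : ‖A t‖ ≤ C * R := (hC t).trans (by gcongr)
        gcongr
      rw [Submodule.coe_norm]
      have h3 : 0 < Real.pi * τ.im := by positivity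
      nlinarith
  · simp only [hF]
    refine Summable.mul_left _ ?_
    have := summable_exp_neg_norm_sq L (a := Real.pi * (-1 / τ).im) (by positivity)
    refine Summable.of_norm_bounded (e.summable_iff.2 this) fun k => ?_
    rw [norm_cexp_mul_norm_sq]
    rfl

end Lattice

section ExpSeries

variable {ι : Type*}

lemma norm_cexp_pi_mul_I (τ : ℂ) :
    ‖Complex.exp (Real.pi * Complex.I * τ)‖ = Real.exp (-(Real.pi * τ.im)) := by
  rw [Complex.norm_exp]
  simp

lemma norm_cexp_pi_mul_ofReal (τ : ℂ) (r : ℝ) :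
    ‖Complex.exp (Real.pi * Complex.I * τ * r)‖ = Real.exp (-(Real.pi * τ.im * r)) := by
  rw [Complex.norm_exp, Complex.re_mul_ofReal]
  simp

lemma norm_mul_cexp_le {a : ℂ} (ha : ‖a‖ ≤ 1) (τ : ℂ) (r : ℝ) :
    ‖a * Complex.exp (Real.pi * Complex.I * τ * r)‖ ≤ Real.exp (-(Real.pi * τ.im * r)) := by
  rw [norm_mul, norm_cexp_pi_mul_ofReal]
  exact mul_le_of_le_one_left (Real.exp_pos _).le ha

lemma differentiableOn_tsum_cexp {a : ι → ℂ} {s : ι → ℝ} (ha : ∀ i, ‖a i‖ ≤ 1)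
    (h0 : ∀ i, 0 ≤ s i) (hs : ∀ b : ℝ, 0 < b → Summable fun i => Real.exp (-(b * s i))) :
    DifferentiableOn ℂ (fun τ => ∑' i, a i * Complex.exp (Real.pi * Complex.I * τ * s i))
      {τ | 0 < τ.im} := by
  intro τ hτ
  have hτ' : 0 < τ.im := hτ
  have hU : IsOpen {σ : ℂ | τ.im / 2 < σ.im} := isOpen_lt continuous_const Complex.continuous_im
  have hmem : τ ∈ {σ : ℂ | τ.im / 2 < σ.im} := half_lt_self hτ'
  have := Complex.differentiableOn_tsum_of_summable_norm
    (F := fun i τ => a i * Complex.exp (Real.pi * Complex.I * τ * s i))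
    (U := {σ : ℂ | τ.im / 2 < σ.im})
    (hs (Real.pi * (τ.im / 2)) (by positivity)) (fun i => by fun_prop) hU (fun i σ hσ => ?_)
  · exact (this.differentiableAt (hU.mem_nhds hmem)).differentiableWithinAt
  · refine (norm_mul_cexp_le (ha i) σ (s i)).trans ?_
    have := h0 i
    have : τ.im / 2 < σ.im := hσ
    gcongr

lemma norm_tsum_sub_sum_le {a : ι → ℂ} {s : ι → ℝ} (ha : ∀ i, ‖a i‖ ≤ 1)
    (hs : ∀ b : ℝ, 0 < b → Summable fun i => Real.exp (-(b * s i)))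
    (T : Finset ι) (m : ℕ) (hm : ∀ i ∉ T, m ≤ s i) :
    ∃ C : ℝ, ∀ τ : ℂ, 1 ≤ τ.im →
      ‖∑' i, a i * Complex.exp (Real.pi * Complex.I * τ * s i) -
        ∑ i ∈ T, a i * Complex.exp (Real.pi * Complex.I * τ * s i)‖ ≤
      C * ‖Complex.exp (Real.pi * Complex.I * τ)‖ ^ m := by
  refine ⟨(∑' i, Real.exp (-(Real.pi * s i))) * Real.exp (Real.pi * m), fun τ hτ => ?_⟩
  have hsum : Summable fun i => a i * Complex.exp (Real.pi * Complex.I * τ * s i) :=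
    Summable.of_norm_bounded (hs (Real.pi * τ.im) (by positivity))
      fun i => norm_mul_cexp_le (ha i) τ (s i)
  rw [← hsum.sum_add_tsum_compl (s := T), add_sub_cancel_left, norm_cexp_pi_mul_I]
  have hu := hs Real.pi Real.pi_pos
  have hu' := (hu.subtype (↑T : Set ι)ᶜ).mul_right
    (Real.exp (Real.pi * m) * Real.exp (-(Real.pi * τ.im)) ^ m)
  refine (tsum_of_norm_bounded hu'.hasSum fun i => ?_).trans ?_
  · refine (norm_mul_cexp_le (ha i) τ (s i)).trans ?_
    simp only [Function.comp_apply]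
    rw [← Real.exp_nat_mul, ← Real.exp_add, ← Real.exp_add, Real.exp_le_exp]
    have h1 : (m : ℝ) ≤ s i := hm i fun h => i.2 (Finset.mem_coe.2 h)
    have h2 : 0 ≤ (τ.im - 1) * (s i - m) := mul_nonneg (by linarith) (by linarith)
    have := mul_nonneg Real.pi_pos.le h2
    linarith
  · rw [tsum_mul_right, mul_assoc]
    gcongr
    exact hu.tsum_subtype_le _ _ fun i => (Real.exp_pos _).le

end ExpSeries

section SelfDual

variable {E : Type*} [NormedAddCommGroup E] [InnerProductSpace ℝ E] {L : Submodule ℤ E}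

lemma IsSelfDual.exists_norm_sq_eq (hL : IsSelfDual L) {x : E} (hx : x ∈ L) :
    ∃ m : ℤ, ‖x‖ ^ 2 = m := by
  obtain ⟨m, hm⟩ := (hL x).1 hx x hx
  exact ⟨m, by rw [← hm, real_inner_self_eq_norm_sq]⟩

lemma IsSelfDual.one_le_norm (hL : IsSelfDual L) {x : E} (hx : x ∈ L) (h0 : x ≠ 0) :
    1 ≤ ‖x‖ := by
  obtain ⟨m, hm⟩ := hL.exists_norm_sq_eq hx
  have h1 : 0 < ‖x‖ ^ 2 := by positivity
  rw [hm] at h1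
  have h2 : 1 ≤ m := by exact_mod_cast h1
  have h3 : (1 : ℝ) ≤ ‖x‖ ^ 2 := by rw [hm]; exact_mod_cast h2
  nlinarith [norm_nonneg x]

lemma IsSelfDual.discreteTopology (hL : IsSelfDual L) : DiscreteTopology L :=
  DiscreteTopology.of_forall_le_norm one_pos fun x hx =>
    hL.one_le_norm x.2 fun h => hx (Subtype.ext h)

lemma IsSelfDual.span_eq_top [FiniteDimensional ℝ E] (hL : IsSelfDual L) :
    Submodule.span ℝ (L : Set E) = ⊤ := by
  by_contra h
  have h1 : (Submodule.span ℝ (L : Set E))ᗮ ≠ ⊥ := fun h2 =>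
    h ((Submodule.orthogonal_eq_bot_iff).1 h2)
  obtain ⟨v, hv, hv0⟩ := Submodule.exists_mem_ne_zero_of_ne_bot h1
  have h3 : ∀ t : ℝ, t • v ∈ L := by
    intro t
    rw [hL]
    intro w hw
    refine ⟨0, ?_⟩
    rw [real_inner_smul_left, real_inner_comm,
      (Submodule.mem_orthogonal _ _).1 hv w (Submodule.subset_span hw)]
    simp
  have hn : 0 < ‖v‖ := norm_pos_iff.2 hv0
  have h4 := hL.one_le_norm (h3 (2 * ‖v‖)⁻¹) (smul_ne_zero (by positivity) hv0)
  rw [norm_smul, Real.norm_of_nonneg (by positivity)] at h4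
  field_simp at h4
  norm_num at h4

end SelfDual

section Theta

variable {E : Type*} [NormedAddCommGroup E] [InnerProductSpace ℝ E] (L : Submodule ℤ E)

/-- The theta series of the translate `L + v`. -/
noncomputable def shiftTheta (v : E) (τ : ℂ) : ℂ :=
  ∑' x : L, Complex.exp (Real.pi * Complex.I * τ * (‖(x : E) + v‖ ^ 2 : ℝ))

/-- The theta series of `L` twisted by the character `x ↦ exp (2πi⟪x, v⟫)`. -/
noncomputable def twistTheta (v : E) (τ : ℂ) : ℂ :=
  ∑' x : L, Complex.exp (Real.pi * Complex.I * τ * (‖(x : E)‖ ^ 2 : ℝ)) *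
    Complex.exp (2 * Real.pi * Complex.I * (⟪(x : E), v⟫ : ℝ))

lemma twistTheta_zero (τ : ℂ) : twistTheta L 0 τ = shiftTheta L 0 τ := by
  simp [twistTheta, shiftTheta]

/-- `w` is a characteristic vector of `L`. -/
def IsCharacteristic (L : Submodule ℤ E) (w : E) : Prop :=
  ∀ x ∈ L, ∃ m : ℤ, ‖x‖ ^ 2 - ⟪x, w⟫ = 2 * m

variable {L}

lemma IsCharacteristic.cexp_eq {w : E} (hw : IsCharacteristic L w) {x : E} (hx : x ∈ L) :
    Complex.exp (Real.pi * Complex.I * (‖x‖ ^ 2 : ℝ)) =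
      Complex.exp (2 * Real.pi * Complex.I * (⟪x, (2⁻¹ : ℝ) • w⟫ : ℝ)) := by
  obtain ⟨m, hm⟩ := hw x hx
  rw [Complex.exp_eq_exp_iff_exists_int]
  refine ⟨m, ?_⟩
  rw [real_inner_smul_right, show ‖x‖ ^ 2 = ⟪x, w⟫ + 2 * m by linarith]
  push_cast
  ring

lemma IsCharacteristic.shiftTheta_add_one {w : E} (hw : IsCharacteristic L w) (τ : ℂ) :
    shiftTheta L 0 (τ + 1) = twistTheta L ((2⁻¹ : ℝ) • w) τ := by
  refine tsum_congr fun x => ?_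
  rw [← hw.cexp_eq x.2, ← Complex.exp_add, add_zero]
  ring_nf

lemma IsCharacteristic.twistTheta_add_one (hL : IsSelfDual L) {w : E}
    (hw : IsCharacteristic L w) (τ : ℂ) :
    twistTheta L ((2⁻¹ : ℝ) • w) (τ + 1) = shiftTheta L 0 τ := by
  refine tsum_congr fun x => ?_
  rw [← hw.cexp_eq x.2, ← Complex.exp_add, add_zero]
  obtain ⟨m, hm⟩ := hL.exists_norm_sq_eq x.2
  rw [Complex.exp_eq_exp_iff_exists_int]
  refine ⟨m, ?_⟩
  rw [hm]
  push_cast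
  ring

lemma norm_add_half_smul_sq (x w : E) :
    ‖x + (2⁻¹ : ℝ) • w‖ ^ 2 = ‖x‖ ^ 2 + ⟪x, w⟫ + ‖w‖ ^ 2 / 4 := by
  rw [norm_add_sq_real, real_inner_smul_right, norm_smul, Real.norm_of_nonneg (by norm_num)]
  ring

lemma IsCharacteristic.exists_norm_add_half_smul_sq (hL : IsSelfDual L) {w : E}
    (hw : IsCharacteristic L w) {x : E} (hx : x ∈ L) (hwL : w ∈ L) :
    ∃ m : ℤ, ‖x + (2⁻¹ : ℝ) • w‖ ^ 2 = 2 * m + ‖w‖ ^ 2 / 4 := by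
  obtain ⟨m, hm⟩ := hw x hx
  obtain ⟨p, hp⟩ := (hL x).1 hx w hwL
  refine ⟨m + p, ?_⟩
  rw [norm_add_half_smul_sq]
  push_cast
  linarith

lemma IsCharacteristic.shiftTheta_half_add_one (hL : IsSelfDual L) {w : E}
    (hw : IsCharacteristic L w) (hwL : w ∈ L) (τ : ℂ) :
    shiftTheta L ((2⁻¹ : ℝ) • w) (τ + 1) =
      Complex.exp (Real.pi * Complex.I * (‖w‖ ^ 2 / 4 : ℝ)) *
        shiftTheta L ((2⁻¹ : ℝ) • w) τ := by
  rw [shiftTheta, shiftTheta, ← tsum_mul_left]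
  refine tsum_congr fun x => ?_
  rw [← Complex.exp_add, Complex.exp_eq_exp_iff_exists_int]
  obtain ⟨m, hm⟩ := hw.exists_norm_add_half_smul_sq hL x.2 hwL
  refine ⟨m, ?_⟩
  rw [hm]
  push_cast
  ring

variable (L) [FiniteDimensional ℝ E]

lemma shiftTheta_I_ne_zero [DiscreteTopology L] (v : E) : shiftTheta L v Complex.I ≠ 0 := by
  have h : shiftTheta L v Complex.I =
      ((∑' x : L, Real.exp (-(Real.pi * ‖(x : E) + v‖ ^ 2)) : ℝ) : ℂ) := by
    rw [shiftTheta, Complex.ofReal_tsum]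
    refine tsum_congr fun x => ?_
    push_cast
    congr 1
    linear_combination (Real.pi * (‖(x : E) + v‖ : ℂ) ^ 2) * Complex.I_sq
  rw [h]
  have := (summable_exp_neg_norm_add_sq L Real.pi_pos v).tsum_pos
    (fun x => (Real.exp_pos _).le) 0 (Real.exp_pos _)
  exact_mod_cast this.ne'

variable {L}

/-- The modular transformation of theta series of self-dual lattices in dimension `36`. -/
lemma IsSelfDual.shiftTheta_eq (hL : IsSelfDual L) (hE : finrank ℝ E = 36) (v : E) {τ : ℂ}
    (hτ : 0 < τ.im) : τ ^ 18 * shiftTheta L v τ = -twistTheta L v (-1 / τ) := by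
  borelize E
  have := hL.discreteTopology
  have : IsZLattice ℝ L := ⟨hL.span_eq_top⟩
  obtain ⟨c, hc⟩ := hL.exists_tsum_eq
  have h : ∀ {τ : ℂ}, 0 < τ.im → ∀ v,
      shiftTheta L v τ = c * (-(Complex.I * τ))⁻¹ ^ 18 * twistTheta L v (-1 / τ) := by
    intro τ hτ v
    have h18 : ((finrank ℝ E : ℂ) / 2) = (18 : ℕ) := by rw [hE]; norm_num
    have := hc τ hτ v
    rwa [h18, Complex.cpow_natCast] at this
  have hc1 : (c : ℂ) = 1 := by
    have h1 := h (τ := Complex.I) (by simp) 0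
    rw [twistTheta_zero, neg_div, one_div, Complex.inv_I, neg_neg, Complex.I_mul_I, neg_neg] at h1
    have h2 := shiftTheta_I_ne_zero L 0
    have h3 : ((c : ℂ) - 1) * shiftTheta L 0 Complex.I = 0 := by
      linear_combination -h1
    rcases mul_eq_zero.1 h3 with h4 | h4
    · linear_combination h4
    · exact absurd h4 h2
  have hτ0 : τ ≠ 0 := by rintro rfl; simp at hτ
  rw [h hτ v, hc1, inv_pow, neg_pow, mul_pow]
  have hI : Complex.I ^ 18 = -1 := by
    rw [show 18 = 2 * 9 from rfl, pow_mul, Complex.I_sq]; norm_num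
  rw [hI]
  field_simp

lemma neg_one_div_im_pos {τ : ℂ} (hτ : 0 < τ.im) : 0 < (-1 / τ).im := by
  have hτ0 : τ ≠ 0 := by rintro rfl; simp at hτ
  rw [neg_div, one_div, Complex.neg_im, Complex.inv_im, neg_div, neg_neg]
  exact div_pos hτ (Complex.normSq_pos.2 hτ0)

lemma IsSelfDual.twistTheta_neg_one_div (hL : IsSelfDual L) (hE : finrank ℝ E = 36) (v : E)
    {τ : ℂ} (hτ : 0 < τ.im) : twistTheta L v (-1 / τ) = -τ ^ 18 * shiftTheta L v τ := by
  linear_combination hL.shiftTheta_eq hE v hτ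

lemma IsSelfDual.shiftTheta_neg_one_div (hL : IsSelfDual L) (hE : finrank ℝ E = 36) (v : E)
    {τ : ℂ} (hτ : 0 < τ.im) : shiftTheta L v (-1 / τ) = -τ ^ 18 * twistTheta L v τ := by
  have hτ0 : τ ≠ 0 := by rintro rfl; simp at hτ
  have h := hL.shiftTheta_eq hE v (neg_one_div_im_pos hτ)
  rw [show -1 / (-1 / τ) = τ by field_simp, div_pow] at h
  field_simp at h
  rw [neg_div]
  linear_combination h

lemma IsSelfDual.exists_isCharacteristic (hL : IsSelfDual L) :
    ∃ w ∈ L, IsCharacteristic L w := by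
  have := hL.discreteTopology
  have : IsZLattice ℝ L := ⟨hL.span_eq_top⟩
  have : Module.Free ℤ L := ZLattice.module_free ℝ L
  have : Module.Finite ℤ L := ZLattice.module_finite ℝ L
  let b := Module.Free.chooseBasis ℤ L
  obtain ⟨e, he⟩ := hL.exists_dual_equiv b
  choose k hk using fun i => hL.exists_norm_sq_eq (b i).2
  refine ⟨e k, (e k).2, fun x hx => ?_⟩
  have hmem : (⟨x, hx⟩ : L) ∈ Submodule.span ℤ (Set.range b) := by
    rw [b.span_eq]; trivial
  suffices h : ∀ y : L, y ∈ Submodule.span ℤ (Set.range b) →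
      ∃ m : ℤ, ‖(y : E)‖ ^ 2 - ⟪(y : E), (e k : E)⟫ = 2 * m from h _ hmem
  intro y hy
  induction hy using Submodule.span_induction with
  | mem y hy =>
    obtain ⟨i, rfl⟩ := hy
    refine ⟨0, ?_⟩
    rw [real_inner_comm, he, hk]
    simp
  | zero => exact ⟨0, by simp⟩
  | add y z _ _ h1 h2 =>
    obtain ⟨m, hm⟩ := h1
    obtain ⟨n, hn⟩ := h2
    obtain ⟨p, hp⟩ := (hL y).1 y.2 z z.2
    refine ⟨m + n + p, ?_⟩
    rw [Submodule.coe_add, norm_add_sq_real, inner_add_left, hp]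
    push_cast
    linear_combination hm + hn
  | smul c y _ h1 =>
    obtain ⟨m, hm⟩ := h1
    obtain ⟨p, hp⟩ := (hL y).1 y.2 y y.2
    obtain ⟨q, hq⟩ := Int.even_mul_pred_self c
    refine ⟨q * p + c * m, ?_⟩
    rw [real_inner_self_eq_norm_sq] at hp
    rw [Submodule.coe_smul, ← Int.cast_smul_eq_zsmul ℝ, norm_smul, real_inner_smul_left, mul_pow,
      Real.norm_eq_abs, sq_abs]
    have hq' : (c : ℝ) * (c - 1) = q + q := by exact_mod_cast hq
    push_cast
    linear_combination (c : ℝ) * hm + (p : ℝ) * hq' + ((c : ℝ) ^ 2 - c) * hp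

/-- The norm of a characteristic vector in dimension `36` is `4` modulo `8`. -/
lemma IsCharacteristic.cexp_norm_sq (hL : IsSelfDual L) (hE : finrank ℝ E = 36) {w : E}
    (hw : IsCharacteristic L w) (hwL : w ∈ L) :
    Complex.exp (Real.pi * Complex.I * (‖w‖ ^ 2 / 4 : ℝ)) = -1 := by
  set v : E := (2⁻¹ : ℝ) • w with hv
  set τ := Complex.I with hτ
  have hI : 0 < τ.im := by simp [hτ]
  have hI1 : 0 < (τ + 1).im := by simp [hτ]
  have hτ0 : τ ≠ 0 := Complex.I_ne_zero
  have hτ1 : τ + 1 ≠ 0 := by intro h; rw [h] at hI1; simp at hI1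
  set σ := -1 / τ - 1 with hσ
  have hσI : 0 < σ.im := by
    have := neg_one_div_im_pos hI
    simpa [hσ] using this
  have e1 : -1 / (τ + 1) + 1 = -1 / σ := by
    have : σ = -(τ + 1) / τ := by rw [hσ]; field_simp; ring
    rw [this]
    field_simp
    ring
  have hF := hw.shiftTheta_add_one (-1 / (τ + 1))
  have h2 := hL.twistTheta_neg_one_div hE v hI1
  have h3 := hw.shiftTheta_half_add_one hL hwL τ
  have h6 := hL.shiftTheta_neg_one_div hE 0 hσI
  rw [twistTheta_zero] at h6
  have h8 := hw.twistTheta_add_one hL σ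
  have h9 := hL.twistTheta_neg_one_div hE v hI
  have h10 : σ + 1 = -1 / τ := by rw [hσ]; ring
  have h11 : σ ^ 18 * τ ^ 18 = (τ + 1) ^ 18 := by
    rw [← mul_pow, show σ * τ = -(τ + 1) by rw [hσ]; field_simp; ring]
    ring
  rw [h10] at h8
  rw [e1, h6, ← h8, h9, h2, h3] at hF
  have := hL.discreteTopology
  have hS : shiftTheta L v τ ≠ 0 := shiftTheta_I_ne_zero L v
  have h12 : (τ + 1) ^ 18 ≠ 0 := pow_ne_zero _ hτ1
  refine mul_left_cancel₀ h12 (mul_right_cancel₀ hS ?_)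
  linear_combination hF - shiftTheta L v τ * h11

/-- In a self-dual lattice of dimension `36` with minimum above `4`, the shadow has minimum at
least `3`. -/
lemma IsCharacteristic.three_le_norm_sq (hL : IsSelfDual L) (hE : finrank ℝ E = 36)
    (hmin : ∀ x ∈ L, x ≠ 0 → 4 < ‖x‖ ^ 2) {w : E} (hw : IsCharacteristic L w) (hwL : w ∈ L)
    {x : E} (hx : x ∈ L) : 3 ≤ ‖x + (2⁻¹ : ℝ) • w‖ ^ 2 := by
  have h1 := hw.cexp_norm_sq hL hE hwL
  rw [← Complex.exp_pi_mul_I, Complex.exp_eq_exp_iff_exists_int] at h1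
  obtain ⟨n, hn⟩ := h1
  have hpi : (Real.pi : ℂ) * Complex.I ≠ 0 :=
    mul_ne_zero (by exact_mod_cast Real.pi_ne_zero) Complex.I_ne_zero
  have h2 : ((‖w‖ ^ 2 / 4 : ℝ) : ℂ) = 1 + 2 * n :=
    mul_left_cancel₀ hpi (by linear_combination hn)
  have h3 : ‖w‖ ^ 2 / 4 = 1 + 2 * n := by exact_mod_cast h2
  obtain ⟨m, hm⟩ := hw.exists_norm_add_half_smul_sq hL hx hwL
  rw [h3] at hm
  have h4 : ‖x + (2⁻¹ : ℝ) • w‖ ^ 2 = ((2 * (m + n) + 1 : ℤ) : ℝ) := by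
    rw [hm]; push_cast; ring
  have h5 : 0 ≤ 2 * (m + n) + 1 := by
    have : 0 ≤ ‖x + (2⁻¹ : ℝ) • w‖ ^ 2 := by positivity
    rw [h4] at this
    exact_mod_cast this
  have h6 : m + n ≠ 0 := by
    intro h
    rw [h] at h4
    have h7 : (2 : ℝ) • x + w = (2 : ℝ) • (x + (2⁻¹ : ℝ) • w) := by
      rw [smul_add, smul_smul]; norm_num
    have h8 : ‖(2 : ℝ) • x + w‖ ^ 2 = 4 := by
      rw [h7, norm_smul, mul_pow, h4]; norm_num
    have h9 : (2 : ℝ) • x + w ∈ L := by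
      rw [two_smul]
      exact L.add_mem (L.add_mem hx hx) hwL
    refine absurd (hmin _ h9 ?_) (by rw [h8]; exact lt_irrefl _)
    intro h10
    rw [h10] at h8
    norm_num at h8
  rw [h4]
  have : 3 ≤ 2 * (m + n) + 1 := by lia
  exact_mod_cast this

/-- The analytic content of a self-dual lattice of dimension `36` with minimum above `4`. -/
theorem IsSelfDual.exists_theta_functions (hL : IsSelfDual L) (hE : finrank ℝ E = 36)
    (hmin : ∀ x ∈ L, x ≠ 0 → 4 < ‖x‖ ^ 2) :
    ∃ F G S : ℂ → ℂ,
      (DifferentiableOn ℂ F {τ | 0 < τ.im} ∧ DifferentiableOn ℂ G {τ | 0 < τ.im} ∧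
        DifferentiableOn ℂ S {τ | 0 < τ.im}) ∧
      (∀ τ, F (τ + 1) = G τ) ∧ (∀ τ, G (τ + 1) = F τ) ∧ (∀ τ, S (τ + 1) = -S τ) ∧
      (∀ τ : ℂ, 0 < τ.im → F (-1 / τ) = -τ ^ 18 * F τ) ∧
      (∀ τ : ℂ, 0 < τ.im → G (-1 / τ) = -τ ^ 18 * S τ) ∧
      (∀ τ : ℂ, 0 < τ.im → S (-1 / τ) = -τ ^ 18 * G τ) ∧
      (∃ C : ℝ, ∀ τ : ℂ, 1 ≤ τ.im →
        ‖F τ - 1‖ ≤ C * ‖Complex.exp (Real.pi * Complex.I * τ)‖ ^ 5) ∧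
      (∃ C : ℝ, ∀ τ : ℂ, 1 ≤ τ.im →
        ‖G τ - 1‖ ≤ C * ‖Complex.exp (Real.pi * Complex.I * τ)‖ ^ 5) ∧
      (∃ C : ℝ, ∀ τ : ℂ, 1 ≤ τ.im →
        ‖S τ‖ ≤ C * ‖Complex.exp (Real.pi * Complex.I * τ)‖ ^ 3) := by
  have := hL.discreteTopology
  obtain ⟨w, hwL, hw⟩ := hL.exists_isCharacteristic
  set v : E := (2⁻¹ : ℝ) • w with hv
  have hsh : ∀ (u : E) (τ : ℂ), shiftTheta L u τ =
      ∑' x : L, (1 : ℂ) * Complex.exp (Real.pi * Complex.I * τ * (‖(x : E) + u‖ ^ 2 : ℝ)) := by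
    intro u τ
    simp only [one_mul]
    rfl
  have htw : ∀ τ : ℂ, twistTheta L v τ =
      ∑' x : L, Complex.exp (2 * Real.pi * Complex.I * (⟪(x : E), v⟫ : ℝ)) *
        Complex.exp (Real.pi * Complex.I * τ * (‖(x : E)‖ ^ 2 : ℝ)) := by
    intro τ
    exact tsum_congr fun x => mul_comm _ _
  have ha : ∀ x : L, ‖Complex.exp (2 * Real.pi * Complex.I * (⟪(x : E), v⟫ : ℝ))‖ ≤ 1 := by
    intro x
    rw [Complex.norm_exp, Complex.re_mul_ofReal]
    simp
  have hmin5 : ∀ x ∉ ({0} : Finset L), ((5 : ℕ) : ℝ) ≤ ‖(x : E)‖ ^ 2 := by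
    intro x hx
    rw [Finset.mem_singleton] at hx
    have h1 := hmin x x.2 fun h => hx (Subtype.ext h)
    obtain ⟨m, hm⟩ := hL.exists_norm_sq_eq x.2
    rw [hm] at h1 ⊢
    have : 4 < m := by exact_mod_cast h1
    exact_mod_cast this
  have hsum0 : ∀ b : ℝ, 0 < b → Summable fun x : L => Real.exp (-(b * ‖(x : E)‖ ^ 2)) :=
    fun b hb => summable_exp_neg_norm_sq L hb
  refine ⟨shiftTheta L 0, twistTheta L v, shiftTheta L v, ⟨?_, ?_, ?_⟩,
    hw.shiftTheta_add_one, hw.twistTheta_add_one hL, fun τ => ?_, fun τ hτ => ?_,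
    fun τ hτ => hL.twistTheta_neg_one_div hE v hτ,
    fun τ hτ => hL.shiftTheta_neg_one_div hE v hτ, ?_, ?_, ?_⟩
  · simp only [funext (hsh 0)]
    exact differentiableOn_tsum_cexp (by simp) (fun x => by positivity)
      fun b hb => summable_exp_neg_norm_add_sq L hb 0
  · simp only [funext htw]
    exact differentiableOn_tsum_cexp ha (fun x => by positivity) hsum0
  · simp only [funext (hsh v)]
    exact differentiableOn_tsum_cexp (by simp) (fun x => by positivity)
      fun b hb => summable_exp_neg_norm_add_sq L hb v
  · rw [hw.shiftTheta_half_add_one hL hwL, hw.cexp_norm_sq hL hE hwL, neg_one_mul]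
  · rw [hL.shiftTheta_neg_one_div hE 0 hτ, twistTheta_zero]
  · obtain ⟨C, hC⟩ := norm_tsum_sub_sum_le (a := fun _ : L => 1) (by simp) hsum0 {0} 5 hmin5
    refine ⟨C, fun τ hτ => ?_⟩
    have := hC τ hτ
    rw [Finset.sum_singleton] at this
    simpa [hsh] using this
  · obtain ⟨C, hC⟩ := norm_tsum_sub_sum_le ha hsum0 {0} 5 hmin5
    refine ⟨C, fun τ hτ => ?_⟩
    have := hC τ hτ
    rw [Finset.sum_singleton] at this
    simpa [htw] using this
  · obtain ⟨C, hC⟩ := norm_tsum_sub_sum_le (a := fun _ : L => 1) (by simp)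
      (fun b hb => summable_exp_neg_norm_add_sq L hb v) ∅ 3
      fun x _ => by exact_mod_cast hw.three_le_norm_sq hL hE hmin hwL x.2
    refine ⟨C, fun τ hτ => ?_⟩
    have := hC τ hτ
    rw [Finset.sum_empty, sub_zero] at this
    rwa [hsh]

end Theta

section NomeExpansion

/-- The nome `exp (π i τ)`. -/
noncomputable def nome (τ : ℂ) : ℂ := Complex.exp (Real.pi * Complex.I * τ)

lemma norm_nome_le_one {τ : ℂ} (hτ : 1 ≤ τ.im) : ‖nome τ‖ ≤ 1 := by
  rw [nome, norm_cexp_pi_mul_I, Real.exp_le_one_iff, neg_nonpos]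
  have := Real.pi_pos
  positivity

lemma nome_add_one (τ : ℂ) : nome (τ + 1) = -nome τ := by
  rw [nome, nome, mul_add, mul_one, Complex.exp_add, Complex.exp_pi_mul_I, mul_neg_one]

lemma differentiable_nome : Differentiable ℂ nome := by
  unfold nome
  fun_prop

lemma cexp_pi_mul_natCast (τ : ℂ) (n : ℕ) :
    Complex.exp (Real.pi * Complex.I * τ * n) = nome τ ^ n := by
  rw [nome, ← Complex.exp_nat_mul, mul_comm]

/-- `f` agrees with the polynomial `p` in the nome up to an error of fifth order. -/
def HasNomeExpansion (f : ℂ → ℂ) (p : Polynomial ℂ) : Prop :=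
  ∃ C : ℝ, ∀ τ : ℂ, 1 ≤ τ.im → ‖f τ - p.eval (nome τ)‖ ≤ C * ‖nome τ‖ ^ 5

lemma exists_norm_eval_nome_le (p : Polynomial ℂ) :
    ∃ B : ℝ, ∀ τ : ℂ, 1 ≤ τ.im → ‖p.eval (nome τ)‖ ≤ B := by
  obtain ⟨B, hB⟩ := (isCompact_closedBall (0 : ℂ) 1).exists_bound_of_continuousOn
    p.continuous.continuousOn
  exact ⟨B, fun τ hτ => hB _ (by simpa using norm_nome_le_one hτ)⟩

namespace HasNomeExpansion

variable {f g : ℂ → ℂ} {p q : Polynomial ℂ}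

lemma add (hf : HasNomeExpansion f p) (hg : HasNomeExpansion g q) :
    HasNomeExpansion (f + g) (p + q) := by
  obtain ⟨C, hC⟩ := hf
  obtain ⟨D, hD⟩ := hg
  refine ⟨C + D, fun τ hτ => ?_⟩
  rw [Polynomial.eval_add, Pi.add_apply, add_sub_add_comm, add_mul]
  exact (norm_add_le _ _).trans (add_le_add (hC τ hτ) (hD τ hτ))

lemma neg (hf : HasNomeExpansion f p) : HasNomeExpansion (-f) (-p) := by
  obtain ⟨C, hC⟩ := hf
  refine ⟨C, fun τ hτ => ?_⟩
  rw [Polynomial.eval_neg, Pi.neg_apply, neg_sub_neg, norm_sub_rev]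
  exact hC τ hτ

lemma sub (hf : HasNomeExpansion f p) (hg : HasNomeExpansion g q) :
    HasNomeExpansion (f - g) (p - q) := by
  rw [sub_eq_add_neg, sub_eq_add_neg]
  exact hf.add hg.neg

lemma mul (hf : HasNomeExpansion f p) (hg : HasNomeExpansion g q) :
    HasNomeExpansion (f * g) (p * q) := by
  obtain ⟨C, hC⟩ := hf
  obtain ⟨D, hD⟩ := hg
  obtain ⟨A, hA⟩ := exists_norm_eval_nome_le p
  obtain ⟨B, hB⟩ := exists_norm_eval_nome_le q
  refine ⟨C * (B + |D|) + A * D, fun τ hτ => ?_⟩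
  have h1 := norm_nome_le_one hτ
  have hg' : ‖g τ‖ ≤ B + |D| := by
    have h2 : ‖g τ - q.eval (nome τ)‖ ≤ |D| := (hD τ hτ).trans <|
      (mul_le_mul_of_nonneg_right (le_abs_self D) (by positivity)).trans <|
        mul_le_of_le_one_right (abs_nonneg D) (pow_le_one₀ (norm_nonneg _) h1)
    have h3 := norm_add_le (q.eval (nome τ)) (g τ - q.eval (nome τ))
    rw [add_sub_cancel] at h3
    linarith [hB τ hτ]
  rw [Polynomial.eval_mul, Pi.mul_apply, show f τ * g τ - p.eval (nome τ) * q.eval (nome τ) =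
    (f τ - p.eval (nome τ)) * g τ + p.eval (nome τ) * (g τ - q.eval (nome τ)) by ring]
  refine (norm_add_le _ _).trans ?_
  rw [norm_mul, norm_mul, add_mul, mul_right_comm, mul_assoc A]
  have hp0 := (norm_nonneg _).trans (hC τ hτ)
  have hA0 := (norm_nonneg _).trans (hA τ hτ)
  gcongr
  · exact hC τ hτ
  · exact hA τ hτ
  · exact hD τ hτ

lemma congr_mod (hf : HasNomeExpansion f p) (h : (Polynomial.X : Polynomial ℂ) ^ 5 ∣ p - q) :
    HasNomeExpansion f q := by
  obtain ⟨C, hC⟩ := hf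
  obtain ⟨r, hr⟩ := h
  obtain ⟨B, hB⟩ := exists_norm_eval_nome_le r
  refine ⟨C + B, fun τ hτ => ?_⟩
  have h1 : p.eval (nome τ) - q.eval (nome τ) = nome τ ^ 5 * r.eval (nome τ) := by
    rw [← Polynomial.eval_sub, hr]
    simp
  rw [← sub_add_sub_cancel _ (p.eval (nome τ)), h1, add_mul]
  refine (norm_add_le _ _).trans (add_le_add (hC τ hτ) ?_)
  rw [norm_mul, norm_pow, mul_comm]
  exact mul_le_mul_of_nonneg_right (hB τ hτ) (by positivity)

lemma comp_add_one (hf : HasNomeExpansion f p) :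
    HasNomeExpansion (fun τ => f (τ + 1)) (p.comp (-Polynomial.X)) := by
  obtain ⟨C, hC⟩ := hf
  refine ⟨C, fun τ hτ => ?_⟩
  have := hC (τ + 1) (by simpa using hτ)
  rw [nome_add_one, norm_neg] at this
  simpa using this

end HasNomeExpansion

lemma hasNomeExpansion_nome : HasNomeExpansion nome Polynomial.X :=
  ⟨0, fun τ _ => by simp⟩

end NomeExpansion

section JacobiTheta

lemma summable_exp_neg_mul_int_sq {b : ℝ} (hb : 0 < b) :
    Summable fun n : ℤ => Real.exp (-(b * (n : ℝ) ^ 2)) := by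
  have h := (summable_jacobiTheta₂_term_iff 0 (((b / Real.pi : ℝ) : ℂ) * Complex.I)).2
    (by simp; positivity)
  refine h.norm.congr fun n => ?_
  rw [norm_jacobiTheta₂_term]
  congr 1
  simp
  field_simp

lemma summable_exp_neg_mul_int_sq_add {b : ℝ} (hb : 0 < b) :
    Summable fun n : ℤ => Real.exp (-(b * ((n : ℝ) ^ 2 + n))) := by
  refine Summable.of_nonneg_of_le (fun n => (Real.exp_pos _).le) (fun n => ?_)
    ((summable_exp_neg_mul_int_sq (half_pos hb)).mul_left (Real.exp (b / 2)))
  rw [← Real.exp_add, Real.exp_le_exp]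
  nlinarith [mul_nonneg hb.le (sq_nonneg ((n : ℝ) + 1))]

lemma int_sq_add_nonneg (n : ℤ) : (0 : ℝ) ≤ (n : ℝ) ^ 2 + n := by
  have : 0 ≤ n ^ 2 + n := by
    rcases le_or_gt 0 n with h | h
    · positivity
    · nlinarith
  exact_mod_cast this

lemma jacobiTheta₂_zero_eq (τ : ℂ) : jacobiTheta₂ 0 τ =
    ∑' n : ℤ, (1 : ℂ) * Complex.exp (Real.pi * Complex.I * τ * ((n : ℝ) ^ 2 : ℝ)) :=
  tsum_congr fun n => by
    rw [jacobiTheta₂_term, one_mul]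
    push_cast
    congr 1
    ring

lemma jacobiTheta₂_half_period_eq (τ : ℂ) : jacobiTheta₂ (τ / 2) τ =
    ∑' n : ℤ, (1 : ℂ) * Complex.exp (Real.pi * Complex.I * τ * ((n : ℝ) ^ 2 + n : ℝ)) :=
  tsum_congr fun n => by
    rw [jacobiTheta₂_term, one_mul]
    push_cast
    congr 1
    ring

lemma jacobiTheta₂_zero_add_one (τ : ℂ) : jacobiTheta₂ 0 (τ + 1) = jacobiTheta₂ (1 / 2) τ := by
  refine tsum_congr fun n => ?_
  rw [jacobiTheta₂_term, jacobiTheta₂_term, Complex.exp_eq_exp_iff_exists_int]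
  obtain ⟨m, hm⟩ := Int.even_mul_succ_self (n - 1)
  refine ⟨m, ?_⟩
  have hm' : ((n : ℂ) - 1) * (n - 1 + 1) = m + m := by exact_mod_cast hm
  linear_combination (Real.pi * Complex.I) * hm'

lemma jacobiTheta₂_half_period_add_one (τ : ℂ) :
    jacobiTheta₂ ((τ + 1) / 2) (τ + 1) = jacobiTheta₂ (τ / 2) τ := by
  refine tsum_congr fun n => ?_
  rw [jacobiTheta₂_term, jacobiTheta₂_term, Complex.exp_eq_exp_iff_exists_int]
  obtain ⟨m, hm⟩ := Int.even_mul_succ_self n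
  refine ⟨m, ?_⟩
  have hm' : (n : ℂ) * (n + 1) = m + m := by exact_mod_cast hm
  linear_combination (Real.pi * Complex.I) * hm'

lemma neg_I_mul_cpow_half_pow_four (τ : ℂ) : ((-Complex.I * τ) ^ (1 / 2 : ℂ)) ^ 4 = -τ ^ 2 := by
  have h : ((-Complex.I * τ) ^ (1 / 2 : ℂ)) ^ 2 = -Complex.I * τ := by
    simp
  rw [show (4 : ℕ) = 2 * 2 from rfl, pow_mul, h, mul_pow, neg_sq, Complex.I_sq, neg_one_mul]

lemma differentiableOn_jacobiTheta₂_zero :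
    DifferentiableOn ℂ (fun τ => jacobiTheta₂ 0 τ) {τ | 0 < τ.im} := fun _ hτ =>
  (differentiableAt_jacobiTheta₂_snd 0 hτ).differentiableWithinAt

lemma differentiableOn_jacobiTheta₂_half :
    DifferentiableOn ℂ (fun τ => jacobiTheta₂ (1 / 2) τ) {τ | 0 < τ.im} := fun _ hτ =>
  (differentiableAt_jacobiTheta₂_snd (1 / 2) hτ).differentiableWithinAt

lemma differentiableOn_jacobiTheta₂_half_period :
    DifferentiableOn ℂ (fun τ => jacobiTheta₂ (τ / 2) τ) {τ | 0 < τ.im} := by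
  simp only [jacobiTheta₂_half_period_eq]
  exact differentiableOn_tsum_cexp (fun _ => by simp) int_sq_add_nonneg
    fun _ hb => summable_exp_neg_mul_int_sq_add hb

open Polynomial in
lemma hasNomeExpansion_jacobiTheta₂_zero :
    HasNomeExpansion (fun τ => jacobiTheta₂ 0 τ) (1 + 2 * X + 2 * X ^ 4) := by
  obtain ⟨C, hC⟩ := norm_tsum_sub_sum_le (ι := ℤ) (a := fun _ => 1) (s := fun n => (n : ℝ) ^ 2)
    (fun _ => by simp) (fun _ hb => summable_exp_neg_mul_int_sq hb) {-2, -1, 0, 1, 2} 5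
    (fun n hn => by
      have h : 5 ≤ n ^ 2 := by
        simp only [Finset.mem_insert, Finset.mem_singleton, not_or] at hn
        have : n ≤ -3 ∨ 3 ≤ n := by lia
        rcases this with h | h <;> nlinarith
      exact_mod_cast h)
  refine ⟨C, fun τ hτ => ?_⟩
  have h := hC τ hτ
  have h0 := cexp_pi_mul_natCast τ 0
  have h1 := cexp_pi_mul_natCast τ 1
  have h4 := cexp_pi_mul_natCast τ 4
  push_cast at h0 h1 h4
  rw [← jacobiTheta₂_zero_eq] at h
  norm_num at h
  norm_num at h1
  rw [h1, h4] at h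
  convert h using 3
  simp
  ring

open Polynomial in
lemma hasNomeExpansion_jacobiTheta₂_half :
    HasNomeExpansion (fun τ => jacobiTheta₂ (1 / 2) τ) (1 - 2 * X + 2 * X ^ 4) := by
  have h := hasNomeExpansion_jacobiTheta₂_zero.comp_add_one
  simp only [jacobiTheta₂_zero_add_one] at h
  convert h using 1
  simp
  ring

open Polynomial in
lemma hasNomeExpansion_jacobiTheta₂_half_period :
    HasNomeExpansion (fun τ => jacobiTheta₂ (τ / 2) τ) (2 + 2 * X ^ 2) := by
  obtain ⟨C, hC⟩ := norm_tsum_sub_sum_le (ι := ℤ) (a := fun _ => 1)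
    (s := fun n => (n : ℝ) ^ 2 + n)
    (fun _ => by simp) (fun _ hb => summable_exp_neg_mul_int_sq_add hb) {-2, -1, 0, 1} 5
    (fun n hn => by
      have h : 5 ≤ n ^ 2 + n := by
        simp only [Finset.mem_insert, Finset.mem_singleton, not_or] at hn
        have : n ≤ -3 ∨ 2 ≤ n := by lia
        rcases this with h | h <;> nlinarith
      exact_mod_cast h)
  refine ⟨C, fun τ hτ => ?_⟩
  have h := hC τ hτ
  have h2 := cexp_pi_mul_natCast τ 2
  push_cast at h2
  rw [← jacobiTheta₂_half_period_eq] at h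
  norm_num at h
  rw [h2] at h
  convert h using 3
  · simp
    ring
  · rfl

lemma jacobiTheta₂_zero_neg_inv_pow_four {τ : ℂ} (hτ : τ ≠ 0) :
    jacobiTheta₂ 0 (-1 / τ) ^ 4 = -τ ^ 2 * jacobiTheta₂ 0 τ ^ 4 := by
  rw [jacobiTheta₂_functional_equation 0 τ, mul_pow, mul_pow, div_pow,
    neg_I_mul_cpow_half_pow_four]
  simp
  field_simp

lemma nome_mul_jacobiTheta₂_half_period_neg_inv_pow_four {τ : ℂ} (hτ : τ ≠ 0) :
    nome (-1 / τ) * jacobiTheta₂ ((-1 / τ) / 2) (-1 / τ) ^ 4 =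
      -τ ^ 2 * jacobiTheta₂ (1 / 2) τ ^ 4 := by
  rw [jacobiTheta₂_functional_equation (1 / 2) τ, mul_pow, mul_pow, div_pow,
    neg_I_mul_cpow_half_pow_four, ← Complex.exp_nat_mul, ← jacobiTheta₂_neg_left (1 / 2 / τ),
    show -(1 / 2 / τ) = -1 / τ / 2 by ring, nome,
    show ((4 : ℕ) : ℂ) * (-Real.pi * Complex.I * (1 / 2) ^ 2 / τ) =
      Real.pi * Complex.I * (-1 / τ) by push_cast; ring]
  field_simp

lemma jacobiTheta₂_half_neg_inv_pow_four {τ : ℂ} (hτ : τ ≠ 0) :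
    jacobiTheta₂ (1 / 2) (-1 / τ) ^ 4 = -τ ^ 2 * (nome τ * jacobiTheta₂ (τ / 2) τ ^ 4) := by
  have hσ : -1 / τ ≠ 0 := div_ne_zero (by simp) hτ
  have h := nome_mul_jacobiTheta₂_half_period_neg_inv_pow_four hσ
  rw [show -1 / (-1 / τ) = τ by field_simp] at h
  rw [h]
  field_simp

open Polynomial in
/-- The fourth powers of the three Jacobi theta constants. -/
theorem exists_theta_constants : ∃ x y z : ℂ → ℂ,
    DifferentiableOn ℂ x {τ | 0 < τ.im} ∧ DifferentiableOn ℂ y {τ | 0 < τ.im} ∧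
    DifferentiableOn ℂ z {τ | 0 < τ.im} ∧
    (∀ τ, x (τ + 1) = -x τ) ∧ (∀ τ, y (τ + 1) = z τ) ∧ (∀ τ, z (τ + 1) = y τ) ∧
    (∀ τ : ℂ, 0 < τ.im → x (-1 / τ) = -τ ^ 2 * y τ) ∧
    (∀ τ : ℂ, 0 < τ.im → y (-1 / τ) = -τ ^ 2 * x τ) ∧
    (∀ τ : ℂ, 0 < τ.im → z (-1 / τ) = -τ ^ 2 * z τ) ∧
    HasNomeExpansion x (16 * X + 64 * X ^ 3) ∧
    HasNomeExpansion y (1 - 8 * X + 24 * X ^ 2 - 32 * X ^ 3 + 24 * X ^ 4) ∧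
    HasNomeExpansion z (1 + 8 * X + 24 * X ^ 2 + 32 * X ^ 3 + 24 * X ^ 4) := by
  have hne : ∀ τ : ℂ, 0 < τ.im → τ ≠ 0 := by
    rintro τ hτ rfl
    simp at hτ
  refine ⟨fun τ => nome τ * jacobiTheta₂ (τ / 2) τ ^ 4, fun τ => jacobiTheta₂ (1 / 2) τ ^ 4,
    fun τ => jacobiTheta₂ 0 τ ^ 4,
    differentiable_nome.differentiableOn.mul (differentiableOn_jacobiTheta₂_half_period.pow 4),
    differentiableOn_jacobiTheta₂_half.pow 4, differentiableOn_jacobiTheta₂_zero.pow 4,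
    fun τ => ?_, fun τ => ?_, fun τ => ?_,
    fun τ hτ => nome_mul_jacobiTheta₂_half_period_neg_inv_pow_four (hne τ hτ),
    fun τ hτ => jacobiTheta₂_half_neg_inv_pow_four (hne τ hτ),
    fun τ hτ => jacobiTheta₂_zero_neg_inv_pow_four (hne τ hτ), ?_, ?_, ?_⟩
  · beta_reduce
    rw [nome_add_one, jacobiTheta₂_half_period_add_one, neg_mul]
  · beta_reduce
    rw [← jacobiTheta₂_zero_add_one, add_assoc, one_add_one_eq_two, jacobiTheta₂_add_right]
  · beta_reduce
    rw [jacobiTheta₂_zero_add_one]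
  · have h := hasNomeExpansion_jacobiTheta₂_half_period
    have h2 := h.mul h
    convert (hasNomeExpansion_nome.mul (h2.mul h2)).congr_mod (q := 16 * X + 64 * X ^ 3)
      ⟨96 + 64 * X ^ 2 + 16 * X ^ 4, by ring⟩ using 1
    funext τ
    simp only [Pi.mul_apply]
    ring
  · have h := hasNomeExpansion_jacobiTheta₂_half
    have h2 := (h.mul h).congr_mod (q := 1 - 4 * X + 4 * X ^ 2 + 4 * X ^ 4)
      ⟨-8 + 4 * X ^ 3, by ring⟩
    convert (h2.mul h2).congr_mod (q := 1 - 8 * X + 24 * X ^ 2 - 32 * X ^ 3 + 24 * X ^ 4)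
      ⟨-32 + 32 * X + 16 * X ^ 3, by ring⟩ using 1
    funext τ
    simp only [Pi.mul_apply]
    ring
  · have h := hasNomeExpansion_jacobiTheta₂_zero
    have h2 := (h.mul h).congr_mod (q := 1 + 4 * X + 4 * X ^ 2 + 4 * X ^ 4)
      ⟨8 + 4 * X ^ 3, by ring⟩
    convert (h2.mul h2).congr_mod (q := 1 + 8 * X + 24 * X ^ 2 + 32 * X ^ 3 + 24 * X ^ 4)
      ⟨32 + 32 * X + 16 * X ^ 3, by ring⟩ using 1
    funext τ
    simp only [Pi.mul_apply]
    ring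

end JacobiTheta

section LevelOne

open UpperHalfPlane ModularForm ModularFormClass MatrixGroups EisensteinSeries

lemma E₄_qExpansion_coeff_two : (qExpansion 1 E₄).coeff 2 = 2160 := by
  have h := E₄_qExpansion_coeff_one
  have hσ : ArithmeticFunction.sigma 3 2 = 9 := by
    simp [ArithmeticFunction.sigma_apply, Nat.Prime.divisors Nat.prime_two]
  rw [E_qExpansion_coeff _ ⟨2, rfl⟩] at h ⊢
  simp [hσ] at h ⊢
  linear_combination 9 * h

lemma E₆_qExpansion_coeff_two : (qExpansion 1 E₆).coeff 2 = -16632 := by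
  have h := E₆_qExpansion_coeff_one
  have hσ : ArithmeticFunction.sigma 5 2 = 33 := by
    simp [ArithmeticFunction.sigma_apply, Nat.Prime.divisors Nat.prime_two]
  rw [E_qExpansion_coeff _ ⟨3, rfl⟩] at h ⊢
  simp [hσ] at h ⊢
  linear_combination 33 * h

lemma coeff_two_mul (p q : PowerSeries ℂ) :
    (p * q).coeff 2 = p.coeff 0 * q.coeff 2 + p.coeff 1 * q.coeff 1 + p.coeff 2 * q.coeff 0 := by
  simp [PowerSeries.coeff_mul, Finset.Nat.antidiagonal_succ]
  ring

lemma coeff_one_mul (p q : PowerSeries ℂ) :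
    (p * q).coeff 1 = p.coeff 0 * q.coeff 1 + p.coeff 1 * q.coeff 0 := by
  simp [PowerSeries.coeff_mul, Finset.Nat.antidiagonal_succ]

lemma coeff_zero_mul (p q : PowerSeries ℂ) :
    (p * q).coeff 0 = p.coeff 0 * q.coeff 0 := by
  simp

lemma E₄_qExpansion_coeff_zero : (qExpansion 1 E₄).coeff 0 = 1 := E_qExpansion_coeff_zero _ ⟨2, rfl⟩

lemma E₆_qExpansion_coeff_zero : (qExpansion 1 E₆).coeff 0 = 1 := E_qExpansion_coeff_zero _ ⟨3, rfl⟩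

lemma eq_zero_of_weight_eq_fourteen {f : ModularForm 𝒮ℒ 14} (h : (qExpansion 1 f).coeff 0 = 0) :
    f = 0 := by
  suffices CuspForm.discriminantEquiv (toCuspForm f h) = 0 by
    simpa [CuspForm.discriminantEquiv.map_eq_zero_iff, DFunLike.ext_iff]
  exact rank_zero_iff_forall_zero.mp levelOne_weight_two_rank_zero _

lemma eq_zero_of_weight_eq_twentySix {f : ModularForm 𝒮ℒ 26}
    (h0 : (qExpansion 1 f).coeff 0 = 0) (h1 : (qExpansion 1 f).coeff 1 = 0) : f = 0 := by
  suffices CuspForm.discriminantEquiv (toCuspForm f h0) = 0 by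
    simpa [CuspForm.discriminantEquiv.map_eq_zero_iff, DFunLike.ext_iff]
  refine eq_zero_of_weight_eq_fourteen ?_
  rw [qExpansion_eq_qExpansion_discriminant_mul f h0, coeff_one_mul,
    discriminant_qExpansion_coeff_one] at h1
  have hd : (qExpansion 1 discriminant).coeff 0 = 0 :=
    CuspFormClass.qExpansion_coeff_zero CuspForm.discriminant one_pos one_mem_strictPeriods_SL
  rw [hd, zero_mul, zero_add, one_mul] at h1
  exact h1

lemma qExpansion_coeff_two_of_weight_eq_twentySix (f : ModularForm 𝒮ℒ 26) :
    (qExpansion 1 f).coeff 2 =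
      -1224 * (qExpansion 1 f).coeff 0 - 48 * (qExpansion 1 f).coeff 1 := by
  set c₀ := (qExpansion 1 f).coeff 0
  set c₁ := (qExpansion 1 f).coeff 1
  let g₁ : ModularForm 𝒮ℒ 26 := ModularForm.mcast (by norm_num) ((E₄.pow 5).mul E₆)
  let g₂ : ModularForm 𝒮ℒ 26 := ModularForm.mcast (by norm_num) ((E₄.pow 2).mul (E₆.pow 3))
  have hg₁ : qExpansion 1 g₁ = qExpansion 1 E₄ ^ 5 * qExpansion 1 E₆ := by
    simp only [g₁, coe_mcast, ModularForm.qExpansion_mul one_pos one_mem_strictPeriods_SL,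
      ModularForm.qExpansion_pow one_pos one_mem_strictPeriods_SL]
  have hg₂ : qExpansion 1 g₂ = qExpansion 1 E₄ ^ 2 * qExpansion 1 E₆ ^ 3 := by
    simp only [g₂, coe_mcast, ModularForm.qExpansion_mul one_pos one_mem_strictPeriods_SL,
      ModularForm.qExpansion_pow one_pos one_mem_strictPeriods_SL]
  let a : ℂ := (1032 * c₀ + c₁) / 1728
  let b : ℂ := (696 * c₀ - c₁) / 1728
  let g : ModularForm 𝒮ℒ 26 := f - (a • g₁ + b • g₂)
  have hexp : qExpansion 1 g = qExpansion 1 f - (a • qExpansion 1 g₁ + b • qExpansion 1 g₂) := by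
    rw [← ModularForm.qExpansion_smul one_pos one_mem_strictPeriods_SL,
      ← ModularForm.qExpansion_smul one_pos one_mem_strictPeriods_SL]
    refine (ModularForm.qExpansion_sub one_pos one_mem_strictPeriods_SL f
      (a • g₁ + b • g₂)).trans (congrArg _ ?_)
    exact ModularForm.qExpansion_add one_pos one_mem_strictPeriods_SL (a • g₁) (b • g₂)
  have hc (i : ℕ) : (qExpansion 1 g).coeff i = (qExpansion 1 f).coeff i -
      (a * (qExpansion 1 E₄ ^ 5 * qExpansion 1 E₆).coeff i +
        b * (qExpansion 1 E₄ ^ 2 * qExpansion 1 E₆ ^ 3).coeff i) := by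
    rw [hexp, hg₁, hg₂]
    simp
  have hz : g = 0 := by
    refine eq_zero_of_weight_eq_twentySix ?_ ?_
    · rw [hc]
      simp only [pow_succ, pow_zero, one_mul, coeff_zero_mul, E₄_qExpansion_coeff_zero,
        E₆_qExpansion_coeff_zero]
      simp only [a, b, c₀]
      ring
    · rw [hc]
      simp only [pow_succ, pow_zero, one_mul, coeff_zero_mul, coeff_one_mul,
        E₄_qExpansion_coeff_zero, E₆_qExpansion_coeff_zero, E₄_qExpansion_coeff_one,
        E₆_qExpansion_coeff_one]
      simp only [a, b, c₀, c₁]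
      ring
  have h2 := hc 2
  have hz' : (qExpansion 1 g).coeff 2 = 0 := by
    rw [hz, FunLike.coe_zero, qExpansion_zero, map_zero]
  simp only [hz', pow_succ, pow_zero, one_mul, coeff_zero_mul, coeff_one_mul, coeff_two_mul,
    E₄_qExpansion_coeff_zero, E₆_qExpansion_coeff_zero, E₄_qExpansion_coeff_one,
    E₆_qExpansion_coeff_one, E₄_qExpansion_coeff_two, E₆_qExpansion_coeff_two] at h2
  linear_combination -h2

open Filter Topology Asymptotics Polynomial in
lemma X_pow_dvd_of_isBigO {d : ℂ[X]} {n : ℕ}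
    (h : (fun z => d.eval z) =O[𝓝[≠] 0] fun z : ℂ => z ^ n) : X ^ n ∣ d := by
  induction n generalizing d with
  | zero => simp
  | succ n ih =>
    have h0 : d.eval 0 = 0 := by
      have h1 : Tendsto (fun z => d.eval z) (𝓝[≠] 0) (𝓝 (d.eval 0)) :=
        d.continuous.continuousAt.mono_left nhdsWithin_le_nhds
      refine tendsto_nhds_unique h1 (h.trans_tendsto ?_)
      have : Tendsto (fun z : ℂ => z ^ (n + 1)) (𝓝 0) (𝓝 (0 ^ (n + 1))) :=
        (continuous_pow _).continuousAt
      rw [zero_pow n.succ_ne_zero] at this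
      exact this.mono_left nhdsWithin_le_nhds
    obtain ⟨e, rfl⟩ : X ∣ d := X_dvd_iff.2 (by rwa [coeff_zero_eq_eval_zero])
    rw [pow_succ']
    refine mul_dvd_mul_left _ (ih ?_)
    have hinv : (fun z : ℂ => z⁻¹) =O[𝓝[≠] 0] fun z : ℂ => z⁻¹ := isBigO_refl _ _
    refine (hinv.mul h).congr' ?_ ?_ <;> filter_upwards [self_mem_nhdsWithin] with z hz
    · simp [inv_mul_cancel_left₀ hz]
    · rw [pow_succ', inv_mul_cancel_left₀ hz]

lemma qParam_two_eq_nome (τ : ℂ) : Function.Periodic.qParam 2 τ = nome τ := by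
  rw [Function.Periodic.qParam, nome]
  congr 1
  push_cast
  ring

lemma qParam_one_eq_nome_sq (τ : ℂ) : Function.Periodic.qParam 1 τ = nome τ ^ 2 := by
  rw [Function.Periodic.qParam, ← cexp_pi_mul_natCast]
  congr 1
  push_cast
  ring

open Filter Topology Asymptotics Polynomial in
lemma qExpansion_coeff_eq_of_hasNomeExpansion {k : ℤ} (f : ModularForm 𝒮ℒ k) {g : ℂ → ℂ}
    (hfg : ∀ τ : ℍ, f τ = g τ) {p : ℂ[X]} (hg : HasNomeExpansion g p) :
    (qExpansion 1 f).coeff 0 = p.coeff 0 ∧ (qExpansion 1 f).coeff 1 = p.coeff 2 ∧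
      (qExpansion 1 f).coeff 2 = p.coeff 4 := by
  set c := fun i => (qExpansion 1 f).coeff i with hc
  have hser := hasFPowerSeriesOnBall_cuspFunction (c := c) one_pos
    (ModularFormClass.analyticAt_cuspFunction_zero f one_pos one_mem_strictPeriods_SL)
    (fun τ => ModularForm.hasSum_qExpansion f one_pos one_mem_strictPeriods_SL τ)
  have h3 := hser.hasFPowerSeriesAt.isBigO_sub_partialSum_pow 3
  have hsq : Tendsto (fun z : ℂ => z ^ 2) (𝓝[≠] 0) (𝓝 0) := by
    have : Tendsto (fun z : ℂ => z ^ 2) (𝓝 0) (𝓝 (0 ^ 2)) := (continuous_pow _).continuousAt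
    rw [zero_pow two_ne_zero] at this
    exact this.mono_left nhdsWithin_le_nhds
  have h5 : (fun z : ℂ => cuspFunction 1 f (z ^ 2) - (c 0 + c 1 * z ^ 2 + c 2 * z ^ 4))
      =O[𝓝[≠] 0] fun z : ℂ => z ^ 5 := by
    have h6 := h3.comp_tendsto hsq
    have h7 : (fun z : ℂ => z ^ 6) =O[𝓝[≠] 0] fun z : ℂ => z ^ 5 :=
      (isLittleO_pow_pow (by norm_num)).isBigO.mono nhdsWithin_le_nhds
    refine IsBigO.trans ?_ h7
    refine (h6.congr (fun z => ?_) fun z => rfl).trans (isBigO_of_le _ fun z => ?_)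
    · simp only [Function.comp, zero_add, FormalMultilinearSeries.partialSum,
        FormalMultilinearSeries.ofScalars_apply_eq, Finset.sum_range_succ, Finset.sum_range_zero,
        smul_eq_mul]
      ring
    · simp [← pow_mul]
  obtain ⟨B, hB⟩ := hg
  have h8 : (fun z : ℂ => cuspFunction 1 f (z ^ 2) - p.eval z) =O[𝓝[≠] 0] fun z : ℂ => z ^ 5 := by
    refine IsBigO.of_bound B ?_
    have hball : ∀ᶠ z : ℂ in 𝓝[≠] 0, ‖z‖ < Real.exp (-Real.pi) :=
      nhdsWithin_le_nhds (by
        simpa [Metric.ball, dist_zero_right] using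
          Metric.ball_mem_nhds (0 : ℂ) (Real.exp_pos (-Real.pi)))
    filter_upwards [hball, self_mem_nhdsWithin] with z hz hz0
    have hq : nome (Function.Periodic.invQParam 2 z) = z := by
      rw [← qParam_two_eq_nome, Function.Periodic.qParam_right_inv two_ne_zero hz0]
    set τ := Function.Periodic.invQParam 2 z
    have hτ : 1 ≤ τ.im := by
      rw [← hq, nome, norm_cexp_pi_mul_I, Real.exp_lt_exp, neg_lt_neg_iff] at hz
      nlinarith [Real.pi_pos]
    have h := hB τ hτ
    rw [hq] at h
    have hf := SlashInvariantFormClass.eq_cuspFunction f (⟨τ, by linarith⟩ : ℍ)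
      one_mem_strictPeriods_SL one_ne_zero
    rw [hfg] at hf
    simp only [qParam_one_eq_nome_sq] at hf
    have hf' : cuspFunction 1 f (z ^ 2) = g τ := by rw [← hf, ← hq]
    rw [hf', norm_pow]
    exact h
  have h9 : X ^ 5 ∣ p - (C (c 0) + C (c 1) * X ^ 2 + C (c 2) * X ^ 4) := by
    refine X_pow_dvd_of_isBigO ((h5.sub h8).congr_left fun z => ?_)
    simp
  have hcoeff := X_pow_dvd_iff.1 h9
  have e0 := hcoeff 0 (by norm_num)
  have e2 := hcoeff 2 (by norm_num)
  have e4 := hcoeff 4 (by norm_num)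
  simp [coeff_X_pow, coeff_C, coeff_C_mul] at e0 e2 e4
  exact ⟨(sub_eq_zero.1 e0).symm, (sub_eq_zero.1 e2).symm, (sub_eq_zero.1 e4).symm⟩

end LevelOne

section Assembly

open UpperHalfPlane ModularForm ModularFormClass MatrixGroups EisensteinSeries in
lemma exists_modularForm_of_hasNomeExpansion {g : ℂ → ℂ} {p : Polynomial ℂ} (k : ℕ)
    (hd : DifferentiableOn ℂ g {τ | 0 < τ.im}) (hT : ∀ τ, g (τ + 1) = g τ)
    (hS : ∀ τ : ℂ, 0 < τ.im → g (-1 / τ) = τ ^ k * g τ) (hp : HasNomeExpansion g p) :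
    ∃ f : ModularForm 𝒮ℒ k, ∀ τ : ℍ, f τ = g τ := by
  set f : ℍ → ℂ := fun τ => g τ with hf
  have hslash : ∀ γ : SL(2, ℤ), f ∣[(k : ℤ)] γ = f := by
    refine SlashInvariantForm.slash_action_generators_SL2Z ?_ ?_
    · ext τ
      rw [SL_slash_apply, ModularGroup.denom_S, modular_S_smul]
      have h := hS τ τ.im_pos
      have h0 : (τ : ℂ) ≠ 0 := τ.ne_zero
      have e : (-(τ : ℂ))⁻¹ = -1 / τ := by rw [inv_neg, neg_div, one_div]
      simp only [hf]
      rw [coe_mk, e, h, zpow_neg, zpow_natCast, mul_right_comm, mul_inv_cancel₀ (pow_ne_zero _ h0),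
        one_mul]
    · ext τ
      rw [SL_slash_apply, modular_T_smul]
      have hden : denom ModularGroup.T τ = 1 := by
        rw [ModularGroup.denom_apply]
        simp [ModularGroup.T]
      simp only [hf]
      rw [hden, one_zpow, mul_one, coe_vadd, Complex.ofReal_one, add_comm, hT]
  refine ⟨{ toFun := f
            slash_action_eq' := fun _ ⟨γ, hγ⟩ ↦ hγ ▸ hslash γ
            holo' := ?_
            bdd_at_cusps' := ?_ }, fun τ => rfl⟩
  · rw [UpperHalfPlane.mdifferentiable_iff]
    refine hd.congr fun τ hτ => ?_
    simp [hf, ofComplex_apply_of_im_pos hτ]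
  · intro c hc
    rw [Subgroup.IsArithmetic.isCusp_iff_isCusp_SL2Z] at hc
    rw [OnePoint.isBoundedAt_iff_forall_SL2Z hc]
    intro γ _
    rw [hslash γ, isBoundedAtImInfty_iff]
    obtain ⟨B, hB⟩ := hp
    obtain ⟨M, hM⟩ := exists_norm_eval_nome_le p
    refine ⟨|B| + M, 1, fun τ hτ => ?_⟩
    have h1 := (hB τ hτ).trans ((mul_le_mul_of_nonneg_right (le_abs_self B) (by positivity)).trans
      (mul_le_of_le_one_right (abs_nonneg B) (pow_le_one₀ (norm_nonneg _) (norm_nome_le_one hτ))))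
    calc ‖f τ‖ = ‖(g τ - p.eval (nome τ)) + p.eval (nome τ)‖ := by simp [hf]
      _ ≤ |B| + M := (norm_add_le _ _).trans (add_le_add h1 (hM τ hτ))

open Polynomial in
lemma HasNomeExpansion.mul_of_isBigO_cube {S w : ℂ → ℂ} {p : ℂ[X]}
    (hS : ∃ B : ℝ, ∀ τ : ℂ, 1 ≤ τ.im → ‖S τ‖ ≤ B * ‖nome τ‖ ^ 3)
    (hw : HasNomeExpansion w p) (hp : X ^ 2 ∣ p) : HasNomeExpansion (S * w) 0 := by
  obtain ⟨B, hB⟩ := hS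
  obtain ⟨D, hD⟩ := hw
  obtain ⟨r, rfl⟩ := hp
  obtain ⟨M, hM⟩ := exists_norm_eval_nome_le r
  refine ⟨B * (|D| + M), fun τ hτ => ?_⟩
  have h1 := norm_nome_le_one hτ
  have h0 := norm_nonneg (nome τ)
  have hw2 : ‖w τ‖ ≤ (|D| + M) * ‖nome τ‖ ^ 2 := by
    have h3 := norm_add_le (w τ - (X ^ 2 * r).eval (nome τ)) ((X ^ 2 * r).eval (nome τ))
    rw [sub_add_cancel] at h3
    refine h3.trans ?_
    rw [add_mul]
    refine add_le_add ((hD τ hτ).trans ?_) ?_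
    · exact mul_le_mul (le_abs_self D) (pow_le_pow_of_le_one h0 h1 (by norm_num)) (by positivity)
        (abs_nonneg D)
    · rw [eval_mul, eval_pow, eval_X, norm_mul, norm_pow, mul_comm]
      exact mul_le_mul_of_nonneg_right (hM τ hτ) (by positivity)
  rw [eval_zero, sub_zero, Pi.mul_apply, norm_mul]
  have hB0 := (norm_nonneg _).trans (hB τ hτ)
  calc ‖S τ‖ * ‖w τ‖ ≤ (B * ‖nome τ‖ ^ 3) * ((|D| + M) * ‖nome τ‖ ^ 2) :=
        mul_le_mul (hB τ hτ) hw2 (norm_nonneg _) hB0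
    _ = B * (|D| + M) * ‖nome τ‖ ^ 5 := by ring

open Polynomial in
theorem IsSelfDual.exists_norm_sq_le_four {E : Type*} [NormedAddCommGroup E]
    [InnerProductSpace ℝ E] [FiniteDimensional ℝ E] {L : Submodule ℤ E} (hL : IsSelfDual L)
    (hE : finrank ℝ E = 36) : ∃ x ∈ L, x ≠ 0 ∧ ‖x‖ ^ 2 ≤ 4 := by
  by_contra! hmin
  obtain ⟨F, G, S, ⟨hFd, hGd, hSd⟩, hFT, hGT, hST, hFS, hGS, hSS, hF, hG, hS⟩ :=
    hL.exists_theta_functions hE hmin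
  obtain ⟨x, y, z, hxd, hyd, hzd, hxT, hyT, hzT, hxS, hyS, hzS, hx, hy, hz⟩ :=
    exists_theta_constants
  have hF1 : HasNomeExpansion F 1 := by
    obtain ⟨B, hB⟩ := hF
    exact ⟨B, fun τ hτ => by rw [eval_one]; exact hB τ hτ⟩
  have hG1 : HasNomeExpansion G 1 := by
    obtain ⟨B, hB⟩ := hG
    exact ⟨B, fun τ hτ => by rw [eval_one]; exact hB τ hτ⟩
  have hy2 : HasNomeExpansion (y * y) (1 - 16 * X + 112 * X ^ 2 - 448 * X ^ 3 + 1136 * X ^ 4) :=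
    (hy.mul hy).congr_mod ⟨-1920 + 2176 * X - 1536 * X ^ 2 + 576 * X ^ 3, by ring⟩
  have hz2 : HasNomeExpansion (z * z) (1 + 16 * X + 112 * X ^ 2 + 448 * X ^ 3 + 1136 * X ^ 4) :=
    (hz.mul hz).congr_mod ⟨1920 + 2176 * X + 1536 * X ^ 2 + 576 * X ^ 3, by ring⟩
  have hy3 : HasNomeExpansion (y * y * y)
      (1 - 24 * X + 264 * X ^ 2 - 1760 * X ^ 3 + 7944 * X ^ 4) :=
    (hy2.mul hy).congr_mod ⟨-23808 + 44288 * X - 47104 * X ^ 2 + 27264 * X ^ 3, by ring⟩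
  have hz3 : HasNomeExpansion (z * z * z)
      (1 + 24 * X + 264 * X ^ 2 + 1760 * X ^ 3 + 7944 * X ^ 4) :=
    (hz2.mul hz).congr_mod ⟨23808 + 44288 * X + 47104 * X ^ 2 + 27264 * X ^ 3, by ring⟩
  have hSx : HasNomeExpansion (S * ((z + y) * (x * x * x))) 0 :=
    HasNomeExpansion.mul_of_isBigO_cube hS ((hz.add hy).mul ((hx.mul hx).mul hx))
      ⟨(2 + 48 * X ^ 2 + 48 * X ^ 4) * (16 + 64 * X ^ 2) ^ 3 * X, by ring⟩
  have hg : HasNomeExpansion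
      (F * (y - x) * (z * z * z) + G * (z + x) * (y * y * y) - S * ((z + y) * (x * x * x)))
      (2 - 576 * X ^ 2 - 60480 * X ^ 4) :=
    ((((hF1.mul (hy.sub hx)).mul hz3).add ((hG1.mul (hz.add hx)).mul hy3)).sub hSx).congr_mod
      ⟨56064 * X + 381312 * X ^ 3, by ring⟩
  obtain ⟨f, hf⟩ := exists_modularForm_of_hasNomeExpansion 26
    ((((hFd.mul (hyd.sub hxd)).mul ((hzd.mul hzd).mul hzd)).add
      ((hGd.mul (hzd.add hxd)).mul ((hyd.mul hyd).mul hyd))).sub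
      (hSd.mul ((hzd.add hyd).mul ((hxd.mul hxd).mul hxd))))
    (fun τ => by
      simp only [Pi.add_apply, Pi.sub_apply, Pi.mul_apply, hFT, hGT, hST, hxT, hyT, hzT]
      ring)
    (fun τ hτ => by
      simp only [Pi.add_apply, Pi.sub_apply, Pi.mul_apply, hFS τ hτ, hGS τ hτ, hSS τ hτ, hxS τ hτ,
        hyS τ hτ, hzS τ hτ]
      ring) hg
  obtain ⟨h0, h1, h2⟩ := qExpansion_coeff_eq_of_hasNomeExpansion f hf hg
  have h := qExpansion_coeff_two_of_weight_eq_twentySix f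
  rw [h0, h1, h2] at h
  have e : (2 - 576 * X ^ 2 - 60480 * X ^ 4 : ℂ[X]) =
      C 2 - C 576 * X ^ 2 - C 60480 * X ^ 4 := by
    simp only [map_ofNat]
  rw [e] at h
  simp only [coeff_sub, coeff_C_mul, coeff_X_pow, coeff_C] at h
  norm_num at h

end Assembly

theorem stmt19 (L : AddSubgroup (Fin 36 → ℝ))
    (huni : (L : Set (Fin 36 → ℝ)) = dualLattice (L : Set (Fin 36 → ℝ))) :
    ∃ x ∈ L, x ≠ 0 ∧ ∑ i, x i * x i ≤ (4 : ℝ) := by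
  let L' : Submodule ℤ (EuclideanSpace ℝ (Fin 36)) := AddSubgroup.toIntSubmodule
    (L.comap (WithLp.linearEquiv 2 ℝ (Fin 36 → ℝ)).toLinearMap.toAddMonoidHom)
  have hmem (v : EuclideanSpace ℝ (Fin 36)) : v ∈ L' ↔ WithLp.ofLp v ∈ L := Iff.rfl
  have hinner (v w : EuclideanSpace ℝ (Fin 36)) : ⟪v, w⟫ = ∑ i, v i * w i := by
    simp [PiLp.inner_apply, mul_comm]
  have hL : IsSelfDual L' := by
    intro v
    rw [hmem, ← SetLike.mem_coe, huni]
    constructor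
    · intro h w hw
      rw [hinner]
      exact h _ hw
    · intro h w hw
      have h1 := h (WithLp.toLp 2 w) hw
      rw [hinner] at h1
      exact h1
  obtain ⟨x, hx, hx0, hx4⟩ := hL.exists_norm_sq_le_four finrank_euclideanSpace_fin
  refine ⟨WithLp.ofLp x, hx, fun h => hx0 ?_, ?_⟩
  · ext i
    exact congrFun h i
  · rwa [← hinner, real_inner_self_eq_norm_sq]
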